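/- arXiv:1302.3640 — 4 statements merged into one kernel-verified Lean document; each statement's English description precedes it below -/
import Mathlib

section
/- Let D be an R-Delone set in ℤᵈ, let L > R be an integer, x ∈ ℤᵈ, and let φ : ℤᵈ → ℂ be supported in Λ_L(x). Then ∑_{γ ∈ D∩Λ_L(x)} |φ(γ)|² ≥ (4R+1)^{−d} ‖φ‖² − 8dR · ‖φ‖ · √(E(φ)). -/
open scoped BigOperators Classical

noncomputable section

/-- The max-norm `|n|_∞` on `ℤᵈ` (as a natural number). -/
def maxNorm {d : ℕ} (n : Fin d → ℤ) : ℕ := Finset.univ.sup fun i => (n i).natAbs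

/-- The `ℓ¹`-norm `|n|₁` on `ℤᵈ` (as a natural number). -/
def oneNorm {d : ℕ} (n : Fin d → ℤ) : ℕ := ∑ i, (n i).natAbs

/-- `D` is an `R`-Delone set in `ℤᵈ`: every cube `x + {0,…,R}ᵈ` contains a point of `D`. -/
def IsDeloneSet (d R : ℕ) (D : Set (Fin d → ℤ)) : Prop :=
  ∀ x : Fin d → ℤ, ∃ γ ∈ D, ∀ i, x i ≤ γ i ∧ γ i ≤ x i + (R : ℤ)

/-- The cube `Λ_L(x)` of side length `2L+1` centered at `x`. -/
def cube (d : ℕ) (L : ℕ) (x : Fin d → ℤ) : Set (Fin d → ℤ) :=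
  {n | maxNorm (n - x) ≤ L}

/-- The squared `ℓ²`-norm `‖φ‖² = ∑_n |φ(n)|²`. -/
def normSq {d : ℕ} (φ : (Fin d → ℤ) → ℂ) : ℝ := ∑' n, ‖φ n‖ ^ 2

/-- The Dirichlet energy `E(φ) = ∑_n ∑_{|m−n|₁=1} |φ(m)−φ(n)|²`. -/
def energy {d : ℕ} (φ : (Fin d → ℤ) → ℂ) : ℝ :=
  ∑' n, ∑' m, if oneNorm (m - n) = 1 then ‖φ m - φ n‖ ^ 2 else 0

theorem aux_path {d : ℕ} (u : (Fin d → ℤ) → ℝ) (n : Fin d → ℤ) (k : ℕ) :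
    ∀ γ : Fin d → ℤ, n ≤ γ → (∑ i, (γ i - n i) = (k : ℤ)) →
    u n ≤ u γ + ∑ m ∈ Finset.Ico n γ, ∑ i, |u (m + Pi.single i 1) - u m| := by
  induction k with
  | zero =>
    intro γ h hs
    have : n = γ := by
      funext i
      have := (Finset.sum_eq_zero_iff_of_nonneg (fun i _ => sub_nonneg.2 (h i))).1
        (by simpa using hs) i (Finset.mem_univ i)
      linarith
    subst this
    simp
  | succ k ih =>
    intro γ h hs
    have hne : ∃ i, n i < γ i := by
      by_contra hc
      push Not at hc
      have : ∑ i, (γ i - n i) ≤ 0 := Finset.sum_nonpos fun i _ => by linarith [hc i]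
      push_cast at hs
      linarith
    obtain ⟨i, hi⟩ := hne
    set γ' : Fin d → ℤ := γ - Pi.single i 1 with hγ'
    have e : γ' + Pi.single i 1 = γ := by simp [hγ']
    have h1 : n ≤ γ' := by
      intro j
      by_cases hj : j = i
      · subst hj; simp [hγ']; omega
      · simp [hγ', hj]; exact h j
    have h2 : ∑ j, (γ' j - n j) = (k : ℤ) := by
      have : ∀ j, γ' j - n j = (γ j - n j) - (Pi.single i 1 : Fin d → ℤ) j := by
        intro j; simp [hγ']; ring
      rw [Finset.sum_congr rfl fun j _ => this j, Finset.sum_sub_distrib, hs]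
      simp
    have h3 := ih γ' h1 h2
    have hlt : γ' < γ := by
      rw [← e]
      refine lt_of_le_of_ne ?_ ?_
      · intro j
        by_cases hj : j = i
        · subst hj; simp
        · simp [hj]
      · intro hh
        have := congrFun hh i
        simp at this
    have hsub : insert γ' (Finset.Ico n γ') ⊆ Finset.Ico n γ := by
      intro m hm
      rcases Finset.mem_insert.1 hm with rfl | hm
      · exact Finset.mem_Ico.2 ⟨h1, hlt⟩
      · rw [Finset.mem_Ico] at hm ⊢
        exact ⟨hm.1, hm.2.trans hlt⟩
    have h4 := Finset.sum_le_sum_of_subset_of_nonneg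
      (f := fun m => ∑ i, |u (m + Pi.single i 1) - u m|) hsub
      (fun m _ _ => Finset.sum_nonneg fun _ _ => abs_nonneg _)
    rw [Finset.sum_insert (by simp)] at h4
    have h5 : |u (γ' + Pi.single i 1) - u γ'| ≤ ∑ i, |u (γ' + Pi.single i 1) - u γ'| :=
      Finset.single_le_sum (f := fun i => |u (γ' + Pi.single i 1) - u γ'|)
        (fun _ _ => abs_nonneg _) (Finset.mem_univ i)
    rw [e] at h5
    have h6 := neg_abs_le (u γ - u γ')
    linarith

theorem aux_cs {α : Type*} (f g : α → ℝ) (hf : Summable fun a => f a ^ 2)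
    (hg : Summable fun a => g a ^ 2) (hfg : Summable fun a => f a * g a) :
    ∑' a, f a * g a ≤ √(∑' a, f a ^ 2) * √(∑' a, g a ^ 2) := by
  refine hfg.tsum_le_of_sum_le fun s => ?_
  refine (Real.sum_mul_le_sqrt_mul_sqrt s f g).trans ?_
  gcongr
  · exact hf.sum_le_tsum s fun _ _ => sq_nonneg _
  · exact hg.sum_le_tsum s fun _ _ => sq_nonneg _

theorem mem_cube_iff {d L : ℕ} {x n : Fin d → ℤ} :
    n ∈ cube d L x ↔ ∀ i, (n i - x i).natAbs ≤ L := by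
  simp [cube, maxNorm]

theorem cube_finite (d L : ℕ) (x : Fin d → ℤ) : (cube d L x).Finite := by
  refine (Set.finite_Icc (fun i => x i - L) (fun i => x i + L)).subset fun n hn => ?_
  rw [mem_cube_iff] at hn
  refine ⟨fun i => ?_, fun i => ?_⟩ <;> · have := hn i; simp only; omega

theorem oneNorm_coord {d : ℕ} {m : Fin d → ℤ} (h : oneNorm m = 1) (i : Fin d) :
    (m i).natAbs ≤ 1 := by
  rw [← h]
  exact Finset.single_le_sum (f := fun i => (m i).natAbs) (fun _ _ => Nat.zero_le _)
    (Finset.mem_univ i)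

theorem aux_shift {d : ℕ} (f : (Fin d → ℤ) → ℝ) (hf : Summable f) (k : Fin d → ℤ) :
    Summable (fun n => f (n + k)) ∧ ∑' n, f (n + k) = ∑' n, f n :=
  ⟨(Equiv.addRight k).summable_iff.2 hf, (Equiv.addRight k).tsum_eq f⟩

theorem aux_energy {d L : ℕ} {x : Fin d → ℤ} (φ : (Fin d → ℤ) → ℂ)
    (hφ : Function.support φ ⊆ cube d L x) (i : Fin d)
    (hs : Summable fun n => ‖φ (n + Pi.single i 1) - φ n‖ ^ 2) :
    ∑' n, ‖φ (n + Pi.single i 1) - φ n‖ ^ 2 ≤ energy φ := by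
  have hin : ∀ n, Summable fun m => if oneNorm (m - n) = 1 then ‖φ m - φ n‖ ^ 2 else 0 := by
    intro n
    refine summable_of_finite_support ((cube_finite d 1 n).subset fun m hm => ?_)
    rw [mem_cube_iff]
    intro j
    have : oneNorm (m - n) = 1 := by
      by_contra h
      simp [h] at hm
    exact oneNorm_coord this j
  refine hs.tsum_le_tsum (fun n => ?_) ?_
  · have := (hin n).le_tsum (n + Pi.single i 1) (fun m _ => by positivity)
    have h1 : oneNorm (n + Pi.single i 1 - n) = 1 := by
      rw [add_sub_cancel_left]
      unfold oneNorm
      rw [Finset.sum_eq_single i] <;> simp +contextual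
    rwa [if_pos h1] at this
  · refine summable_of_finite_support ((cube_finite d (L + 1) x).subset fun n hn => ?_)
    by_contra hc
    apply hn
    have : ∀ m, (if oneNorm (m - n) = 1 then ‖φ m - φ n‖ ^ 2 else 0) = 0 := by
      intro m
      split_ifs with h
      · have h0 : φ n = 0 := by
          by_contra h0
          have := hφ h0
          rw [mem_cube_iff] at this hc
          exact hc fun j => (this j).trans (Nat.le_succ _)
        have h1 : φ m = 0 := by
          by_contra h1
          have := hφ h1
          rw [mem_cube_iff] at this hc
          refine hc fun j => ?_
          have a := this j
          have b := oneNorm_coord h j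
          simp only [Pi.sub_apply] at b
          omega
        simp [h0, h1]
      · rfl
    simp only [this, tsum_zero]

theorem aux_edge {d L : ℕ} {x : Fin d → ℤ} (φ : (Fin d → ℤ) → ℂ)
    (hφ : Function.support φ ⊆ cube d L x) (i : Fin d)
    (hu : Summable fun n => ‖φ n‖ ^ 2) :
    Summable (fun n => |‖φ (n + Pi.single i 1)‖ ^ 2 - ‖φ n‖ ^ 2|) ∧
    ∑' n, |‖φ (n + Pi.single i 1)‖ ^ 2 - ‖φ n‖ ^ 2| ≤ 2 * √(normSq φ) * √(energy φ) := by
  obtain ⟨s1, t1⟩ := aux_shift _ hu (Pi.single i 1)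
  have s2 : Summable fun n => 2 * (‖φ (n + Pi.single i 1)‖ ^ 2 + ‖φ n‖ ^ 2) :=
    (s1.add hu).mul_left 2
  have b1 : ∀ n, (‖φ (n + Pi.single i 1)‖ + ‖φ n‖) ^ 2 ≤
      2 * (‖φ (n + Pi.single i 1)‖ ^ 2 + ‖φ n‖ ^ 2) := fun n => by
    nlinarith [sq_nonneg (‖φ (n + Pi.single i 1)‖ - ‖φ n‖)]
  have b2 : ∀ n, ‖φ (n + Pi.single i 1) - φ n‖ ≤ ‖φ (n + Pi.single i 1)‖ + ‖φ n‖ :=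
    fun n => norm_sub_le _ _
  have b3 : ∀ n, ‖φ (n + Pi.single i 1) - φ n‖ ^ 2 ≤
      2 * (‖φ (n + Pi.single i 1)‖ ^ 2 + ‖φ n‖ ^ 2) := fun n =>
    (pow_le_pow_left₀ (norm_nonneg _) (b2 n) 2).trans (b1 n)
  have b4 : ∀ n, ‖φ (n + Pi.single i 1) - φ n‖ * (‖φ (n + Pi.single i 1)‖ + ‖φ n‖) ≤
      2 * (‖φ (n + Pi.single i 1)‖ ^ 2 + ‖φ n‖ ^ 2) := fun n => by
    refine le_trans ?_ (b1 n)
    rw [sq]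
    exact mul_le_mul_of_nonneg_right (b2 n) (by positivity)
  have b5 : ∀ n, |‖φ (n + Pi.single i 1)‖ ^ 2 - ‖φ n‖ ^ 2| ≤
      ‖φ (n + Pi.single i 1) - φ n‖ * (‖φ (n + Pi.single i 1)‖ + ‖φ n‖) := fun n => by
    rw [sq_sub_sq, abs_mul, mul_comm, abs_of_nonneg (a := ‖φ (n + Pi.single i 1)‖ + ‖φ n‖)
      (by positivity)]
    exact mul_le_mul_of_nonneg_right (abs_norm_sub_norm_le _ _) (by positivity)
  have sf := Summable.of_nonneg_of_le (fun n => by positivity) b3 s2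
  have sg := Summable.of_nonneg_of_le (fun n => by positivity) b1 s2
  have sfg := Summable.of_nonneg_of_le (fun n => by positivity) b4 s2
  have sa := Summable.of_nonneg_of_le (fun n => abs_nonneg _) b5 sfg
  refine ⟨sa, (sa.tsum_le_tsum b5 sfg).trans ((aux_cs _ _ sf sg sfg).trans ?_)⟩
  have c1 := aux_energy φ hφ i sf
  have c2 : ∑' n, (‖φ (n + Pi.single i 1)‖ + ‖φ n‖) ^ 2 ≤ 2 ^ 2 * normSq φ := by
    refine (sg.tsum_le_tsum b1 s2).trans (le_of_eq ?_)
    rw [tsum_mul_left, s1.tsum_add hu, t1, normSq]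
    ring
  calc _ ≤ √(energy φ) * √(2 ^ 2 * normSq φ) := by gcongr
    _ = _ := by
      rw [Real.sqrt_mul (by positivity), Real.sqrt_sq (by norm_num)]; ring

theorem statement3 (d R : ℕ) (hd : 1 ≤ d) (hR : 1 ≤ R) (D : Set (Fin d → ℤ))
    (hD : IsDeloneSet d R D) (L : ℕ) (hL : R < L) (x : Fin d → ℤ)
    (φ : (Fin d → ℤ) → ℂ) (hφ : Function.support φ ⊆ cube d L x) :
    (∑' γ : Fin d → ℤ, if γ ∈ D ∩ cube d L x then ‖φ γ‖ ^ 2 else 0) ≥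
      ((4 * (R : ℝ) + 1) ^ d)⁻¹ * normSq φ -
        8 * (d : ℝ) * (R : ℝ) * Real.sqrt (normSq φ) * Real.sqrt (energy φ) := by
  have hu : Summable fun n => ‖φ n‖ ^ 2 := by
    refine summable_of_finite_support ((cube_finite d L x).subset fun n hn => hφ ?_)
    intro h
    simp [h] at hn
  set v : (Fin d → ℤ) → ℝ := fun γ => if γ ∈ D ∩ cube d L x then ‖φ γ‖ ^ 2 else 0 with hv
  have hv0 : ∀ n, 0 ≤ v n := fun n => by simp only [hv]; positivity
  have sv : Summable v := Summable.of_nonneg_of_le hv0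
    (fun n => by simp only [hv]; split_ifs; exacts [le_rfl, by positivity]) hu
  set G : (Fin d → ℤ) → ℝ := fun m => ∑ i, |‖φ (m + Pi.single i 1)‖ ^ 2 - ‖φ m‖ ^ 2| with hG
  have hG0 : ∀ n, 0 ≤ G n := fun n => Finset.sum_nonneg fun _ _ => abs_nonneg _
  have sG : Summable G := summable_sum fun i _ => (aux_edge φ hφ i hu).1
  have tG : ∑' n, G n ≤ d * (2 * √(normSq φ) * √(energy φ)) := by
    rw [hG, Summable.tsum_finsetSum fun i _ => (aux_edge φ hφ i hu).1]
    refine (Finset.sum_le_sum fun i _ => (aux_edge φ hφ i hu).2).trans ?_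
    simp
  set B : Finset (Fin d → ℤ) := Finset.Icc 0 (fun _ => (R : ℤ)) with hB
  have cB : (B.card : ℝ) = ((R : ℝ) + 1) ^ d := by
    rw [hB, Pi.card_Icc]
    simp
  have key : ∀ n, ‖φ n‖ ^ 2 ≤ ∑ k ∈ B, (v (n + k) + G (n + k)) := by
    intro n
    obtain ⟨γ, hγD, hγ⟩ := hD n
    have hle : n ≤ γ := fun i => (hγ i).1
    have hnn : 0 ≤ ∑ i, (γ i - n i) := Finset.sum_nonneg fun i _ => sub_nonneg.2 (hle i)
    have h1 := aux_path (fun n => ‖φ n‖ ^ 2) n (∑ i, (γ i - n i)).toNat γ hle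
      (Int.toNat_of_nonneg hnn).symm
    have h2 : ‖φ γ‖ ^ 2 = v γ := by
      simp only [hv]
      split_ifs with h
      · rfl
      · have : φ γ = 0 := by
          by_contra h0
          exact h ⟨hγD, hφ h0⟩
        simp [this]
    have hmem : ∀ m, n ≤ m → m ≤ γ → m - n ∈ B := fun m a b => by
      rw [hB, Finset.mem_Icc]
      refine ⟨sub_nonneg.2 a, fun i => ?_⟩
      have := hγ i
      have hb : m i ≤ γ i := b i
      simp only [Pi.sub_apply]; omega
    have h3 : v γ ≤ ∑ k ∈ B, v (n + k) := by
      have := Finset.single_le_sum (f := fun k => v (n + k)) (fun k _ => hv0 _)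
        (hmem γ hle le_rfl)
      simpa using this
    have h4 : ∑ m ∈ Finset.Ico n γ, G m ≤ ∑ k ∈ B, G (n + k) := by
      have e : ∑ m ∈ Finset.Ico n γ, G m
          = ∑ k ∈ (Finset.Ico n γ).image (fun m => m - n), G (n + k) := by
        rw [Finset.sum_image (fun a _ b _ h => by simpa using h)]
        simp
      rw [e]
      refine Finset.sum_le_sum_of_subset_of_nonneg ?_ fun _ _ _ => hG0 _
      intro k hk
      obtain ⟨m, hm, rfl⟩ := Finset.mem_image.1 hk
      rw [Finset.mem_Ico] at hm
      exact hmem m hm.1 hm.2.le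
    rw [Finset.sum_add_distrib]
    simp only [h2] at h1
    linarith
  have svG : ∀ k ∈ B, Summable fun n => (v (n + k) + G (n + k)) := fun k _ =>
    (aux_shift v sv k).1.add (aux_shift G sG k).1
  have main : normSq φ ≤ ((R : ℝ) + 1) ^ d * (∑' n, v n + ∑' n, G n) := by
    refine (hu.tsum_le_tsum key (summable_sum svG)).trans (le_of_eq ?_)
    rw [Summable.tsum_finsetSum svG, ← cB, ← nsmul_eq_mul, ← Finset.sum_const]
    refine Finset.sum_congr rfl fun k _ => ?_
    rw [(aux_shift v sv k).1.tsum_add (aux_shift G sG k).1, (aux_shift v sv k).2,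
      (aux_shift G sG k).2]
  have n1 : 0 ≤ ∑' n, v n + ∑' n, G n := add_nonneg (tsum_nonneg hv0) (tsum_nonneg hG0)
  have main2 : normSq φ ≤ (4 * (R : ℝ) + 1) ^ d * (∑' n, v n + ∑' n, G n) := by
    refine main.trans (mul_le_mul_of_nonneg_right ?_ n1)
    have : (0 : ℝ) ≤ R := by positivity
    exact pow_le_pow_left₀ (by positivity) (by linarith) d
  have main3 : ((4 * (R : ℝ) + 1) ^ d)⁻¹ * normSq φ ≤ ∑' n, v n + ∑' n, G n :=
    (inv_mul_le_iff₀ (by positivity)).2 main2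
  have hR' : (1 : ℝ) ≤ R := by exact_mod_cast hR
  have last : d * (2 * √(normSq φ) * √(energy φ)) ≤
      8 * (d : ℝ) * (R : ℝ) * √(normSq φ) * √(energy φ) := by
    have : 0 ≤ (d : ℝ) * (√(normSq φ) * √(energy φ)) := by positivity
    nlinarith
  linarith
end
end

section
/- (Key positivity estimate for the Wegner bound.) Let D be an R-Delone set in ℤᵈ, let L > R be an integer, x ∈ ℤᵈ, and fix q ∈ (0,1). Set E_W := q² · (8√2 · d · R · (4R+1)^d)^{−2}. Then for every φ : ℤᵈ → ℂ supported in Λ_L(x) satisfying E(φ) ≤ 2 E_W ‖φ‖² (i.e. ⟨−Δφ,φ⟩ ≤ E_W ‖φ‖², which holds in particular for every φ in the range of the spectral projection of the restricted free Laplacian onto [0,E_W]), one has ∑_{γ ∈ D∩Λ_L(x)} |φ(γ)|² ≥ (1−q)(4R+1)^{−d} ‖φ‖². -/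
open scoped BigOperators Classical

noncomputable section

theorem mem_cube_of_oneNorm {d : ℕ} {L : ℕ} {x m n : Fin d → ℤ} (h : oneNorm (m - n) = 1)
    (hm : m ∈ cube d L x) : n ∈ cube d (L + 1) x := by
  rw [mem_cube_iff] at *
  intro i
  have h1 : ((m - n) i).natAbs ≤ oneNorm (m - n) :=
    Finset.single_le_sum (f := fun i => ((m - n) i).natAbs) (fun _ _ => Nat.zero_le _)
      (Finset.mem_univ i)
  have := hm i
  simp only [Pi.sub_apply] at h1
  omega

theorem summable_fs {α : Type*} {f : α → ℝ} {s : Set α} (hs : s.Finite)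
    (h : ∀ a, a ∉ s → f a = 0) : Summable f :=
  summable_of_ne_finset_zero (s := hs.toFinset) (fun b hb => h b (by simpa using hb))

section aux
variable {d L : ℕ} {x : Fin d → ℤ} {φ : (Fin d → ℤ) → ℂ}

theorem phi_zero (hφ : Function.support φ ⊆ cube d L x) {n : Fin d → ℤ} (hn : n ∉ cube d L x) :
    φ n = 0 := by
  by_contra h
  exact hn (hφ h)

theorem summable_diff (hφ : Function.support φ ⊆ cube d L x) (v w : Fin d → ℤ) :
    Summable fun n => ‖φ (n + v) - φ (n + w)‖ ^ 2 := by
  have h1 : ∀ u : Fin d → ℤ, ((fun n => n + u) ⁻¹' cube d L x).Finite := fun u =>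
    (cube_finite d L x).preimage ((add_left_injective u).injOn)
  refine summable_fs ((h1 v).union (h1 w)) ?_
  intro a ha
  simp only [Set.mem_union, Set.mem_preimage, not_or] at ha
  simp [phi_zero hφ ha.1, phi_zero hφ ha.2]

theorem shift_one (hφ : Function.support φ ⊆ cube d L x) (i : Fin d) :
    ∑' n, ‖φ (n + Pi.single i 1) - φ n‖ ^ 2 ≤ energy φ := by
  unfold energy
  have hin : ∀ n, Summable fun m => if oneNorm (m - n) = 1 then ‖φ m - φ n‖ ^ 2 else 0 := by
    intro n
    refine summable_fs (cube_finite d 1 n) ?_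
    intro m hm
    rw [if_neg]
    intro h
    apply hm
    rw [mem_cube_iff]
    intro i
    have h1 : ((m - n) i).natAbs ≤ oneNorm (m - n) :=
      Finset.single_le_sum (f := fun i => ((m - n) i).natAbs) (fun _ _ => Nat.zero_le _)
        (Finset.mem_univ i)
    simp only [Pi.sub_apply] at h1
    omega
  refine Summable.tsum_le_tsum (fun n => ?_) ?_ ?_
  · have h1 : oneNorm (n + Pi.single i 1 - n : Fin d → ℤ) = 1 := by
      rw [add_sub_cancel_left]
      unfold oneNorm
      rw [Finset.sum_eq_single i]
      · simp
      · intro b _ hb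
        simp [Pi.single_eq_of_ne hb]
      · simp
    have := (hin n).le_tsum (n + Pi.single i 1) (fun m _ => by split_ifs <;> positivity)
    rwa [if_pos h1] at this
  · simpa using summable_diff hφ (Pi.single i 1) 0
  · refine summable_fs (cube_finite d (L + 1) x) ?_
    intro n hn
    refine (tsum_congr fun m => ?_).trans tsum_zero
    split_ifs with h
    · have hm : m ∉ cube d L x := fun hm => hn (mem_cube_of_oneNorm h hm)
      have hn' : n ∉ cube d L x := by
        intro h'
        apply hn
        rw [mem_cube_iff] at *
        intro i
        exact (h' i).trans (Nat.le_succ _)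
      simp [phi_zero hφ hm, phi_zero hφ hn']
    · rfl

theorem sq_ineq (a b : ℂ) (k : ℝ) (hk : 0 < k) :
    ‖a + b‖ ^ 2 ≤ (1 + 1 / k) * ‖a‖ ^ 2 + (1 + k) * ‖b‖ ^ 2 := by
  have h1 := norm_add_le a b
  have h2 : ‖a + b‖ ^ 2 ≤ (‖a‖ + ‖b‖) ^ 2 := by gcongr
  refine h2.trans ?_
  have h3 : (1 + 1 / k) * ‖a‖ ^ 2 + (1 + k) * ‖b‖ ^ 2 - (‖a‖ + ‖b‖) ^ 2
      = (‖a‖ - k * ‖b‖) ^ 2 / k := by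
    field_simp
    ring
  have h4 : 0 ≤ (‖a‖ - k * ‖b‖) ^ 2 / k := by positivity
  linarith

theorem energy_nonneg : 0 ≤ energy φ :=
  tsum_nonneg fun _ => tsum_nonneg fun _ => by split_ifs <;> positivity

theorem shift_bound (hφ : Function.support φ ⊆ cube d L x) (k : ℕ) :
    ∀ v : Fin d → ℕ, ∑ i, v i = k →
      ∑' n, ‖φ (n + fun i => (v i : ℤ)) - φ n‖ ^ 2 ≤ (k : ℝ) ^ 2 * energy φ := by
  induction k with
  | zero =>
    intro v hv
    have hv0 : (fun i => (v i : ℤ)) = 0 := by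
      funext i
      have := (Finset.sum_eq_zero_iff.mp hv) i (Finset.mem_univ i)
      simp [this]
    simp [hv0]
  | succ k ih =>
    intro v hv
    obtain ⟨i, hi⟩ : ∃ i, 0 < v i := by
      by_contra! h
      have : ∑ i, v i = 0 := Finset.sum_eq_zero fun i _ => Nat.le_zero.mp (h i)
      omega
    set u : Fin d → ℕ := Function.update v i (v i - 1) with hu
    have huv : (fun j => (v j : ℤ)) = (fun j => (u j : ℤ)) + Pi.single i 1 := by
      funext j
      by_cases hj : j = i
      · subst hj
        simp [hu]
        omega
      · simp [hu, hj]
    have hus : ∑ j, u j = k := by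
      have h1 : ((∑ j, v j : ℕ) : ℤ) = ((∑ j, u j : ℕ) : ℤ) + 1 := by
        push_cast
        have : ∀ j, (v j : ℤ) = (u j : ℤ) + (Pi.single i 1 : Fin d → ℤ) j := fun j =>
          congrFun huv j
        simp_rw [this, Finset.sum_add_distrib]
        simp
      omega
    have hb := ih u hus
    set w : Fin d → ℤ := fun j => (u j : ℤ) with hw
    have hone : ∑' n, ‖φ (n + w + Pi.single i 1) - φ (n + w)‖ ^ 2 ≤ energy φ := by
      have := (Equiv.addRight w).tsum_eq (fun n => ‖φ (n + Pi.single i 1) - φ n‖ ^ 2)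
      simp only [Equiv.coe_addRight] at this
      rw [this]
      exact shift_one hφ i
    rw [huv]
    have s1 : Summable fun n => ‖φ (n + w) - φ n‖ ^ 2 := by
      simpa using summable_diff hφ w 0
    have s2 : Summable fun n => ‖φ (n + w + Pi.single i 1) - φ (n + w)‖ ^ 2 := by
      simpa [add_assoc] using summable_diff hφ (w + Pi.single i 1) w
    have s3 : Summable fun n => ‖φ (n + (w + Pi.single i 1)) - φ n‖ ^ 2 := by
      simpa using summable_diff hφ (w + Pi.single i 1) 0
    have hE := energy_nonneg (φ := φ)
    rcases Nat.eq_zero_or_pos k with hk | hk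
    · subst hk
      have hw0 : w = 0 := by
        funext j
        have := (Finset.sum_eq_zero_iff.mp hus) j (Finset.mem_univ j)
        simp [hw, this]
      simpa [hw0] using hone
    · have hk' : (0 : ℝ) < k := by exact_mod_cast hk
      calc ∑' n, ‖φ (n + (w + Pi.single i 1)) - φ n‖ ^ 2
          ≤ ∑' n, ((1 + 1 / (k : ℝ)) * ‖φ (n + w) - φ n‖ ^ 2
              + (1 + k) * ‖φ (n + w + Pi.single i 1) - φ (n + w)‖ ^ 2) := by
            refine Summable.tsum_le_tsum (fun n => ?_) s3 ((s1.mul_left _).add (s2.mul_left _))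
            have := sq_ineq (φ (n + w) - φ n) (φ (n + w + Pi.single i 1) - φ (n + w)) k hk'
            rw [sub_add_sub_cancel'] at this
            rwa [← add_assoc n w]
        _ = (1 + 1 / (k : ℝ)) * ∑' n, ‖φ (n + w) - φ n‖ ^ 2
              + (1 + k) * ∑' n, ‖φ (n + w + Pi.single i 1) - φ (n + w)‖ ^ 2 := by
            rw [(s1.mul_left _).tsum_add (s2.mul_left _), tsum_mul_left, tsum_mul_left]
        _ ≤ (1 + 1 / (k : ℝ)) * ((k : ℝ) ^ 2 * energy φ) + (1 + k) * energy φ := by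
            gcongr
        _ = ((k + 1 : ℕ) : ℝ) ^ 2 * energy φ := by
            push_cast
            field_simp
            ring

end aux

set_option maxHeartbeats 1000000

theorem statement4 (d R : ℕ) (hd : 1 ≤ d) (hR : 1 ≤ R) (D : Set (Fin d → ℤ))
    (hD : IsDeloneSet d R D) (L : ℕ) (hL : R < L) (x : Fin d → ℤ)
    (q : ℝ) (hq : q ∈ Set.Ioo (0 : ℝ) 1)
    (φ : (Fin d → ℤ) → ℂ) (hφ : Function.support φ ⊆ cube d L x)
    (hE : energy φ ≤
      2 * (q ^ 2 * ((8 * Real.sqrt 2 * (d : ℝ) * (R : ℝ) * (4 * (R : ℝ) + 1) ^ d) ^ 2)⁻¹) *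
        normSq φ) :
    (∑' γ : Fin d → ℤ, if γ ∈ D ∩ cube d L x then ‖φ γ‖ ^ 2 else 0) ≥
      (1 - q) * ((4 * (R : ℝ) + 1) ^ d)⁻¹ * normSq φ := by
  obtain ⟨hq0, hq1⟩ := hq
  have hEn := energy_nonneg (φ := φ)
  have hN : 0 ≤ normSq φ := tsum_nonneg fun _ => by positivity
  let V := Fin d → Fin (R + 1)
  let c : V → (Fin d → ℤ) := fun v i => ((v i : ℕ) : ℤ)
  let g : (Fin d → ℤ) → ℝ := fun γ => if γ ∈ D ∩ cube d L x then ‖φ γ‖ ^ 2 else 0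
  have hg0 : ∀ n, 0 ≤ g n := fun n => by
    simp only [g]
    split_ifs <;> positivity
  have hgs : Summable g := by
    refine summable_fs (cube_finite d L x) (fun n hn => ?_)
    exact if_neg fun h => hn h.2
  have hNs : Summable fun n => ‖φ n‖ ^ 2 :=
    summable_fs (cube_finite d L x) (fun n hn => by simp [phi_zero hφ hn])
  have hds : ∀ v : V, Summable fun n => ‖φ (n + c v) - φ n‖ ^ 2 := fun v => by
    simpa using summable_diff hφ (c v) 0
  have hgsv : ∀ v : V, Summable fun n => g (n + c v) := fun v =>
    (Equiv.addRight (c v)).summable_iff.mpr hgs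
  have hpt : ∀ n, (1 - q / 2) * ‖φ n‖ ^ 2 ≤
      ∑ v : V, (g (n + c v) + (2 / q) * ‖φ (n + c v) - φ n‖ ^ 2) := by
    intro n
    obtain ⟨γ, hγD, hγ⟩ := hD n
    let v : V := fun i => ⟨(γ i - n i).toNat, by have := hγ i; omega⟩
    have hv : n + c v = γ := by
      funext i
      have := hγ i
      simp only [c, v, Pi.add_apply]
      omega
    refine le_trans ?_ (Finset.single_le_sum
      (f := fun v : V => g (n + c v) + (2 / q) * ‖φ (n + c v) - φ n‖ ^ 2)
      (fun v _ => add_nonneg (hg0 _) (by positivity)) (Finset.mem_univ v))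
    simp only [hv]
    have hgγ : g γ = ‖φ γ‖ ^ 2 := by
      simp only [g]
      split_ifs with h
      · rfl
      · have : φ γ = 0 := phi_zero hφ fun h' => h ⟨hγD, h'⟩
        simp [this]
    rw [hgγ]
    have h1 : ‖φ n‖ ≤ ‖φ γ‖ + ‖φ γ - φ n‖ := by
      have := norm_sub_le (φ γ) (φ γ - φ n)
      rwa [sub_sub_cancel] at this
    set a := ‖φ γ‖
    set b := ‖φ n‖
    set e := ‖φ γ - φ n‖
    have ha : 0 ≤ a := norm_nonneg _
    have hb : 0 ≤ b := norm_nonneg _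
    have he : 0 ≤ e := norm_nonneg _
    have h2 : b ^ 2 - 2 * b * e ≤ a ^ 2 := by
      rcases le_total e b with h | h
      · nlinarith
      · nlinarith
    have h3 : q / 2 * b ^ 2 + 2 / q * e ^ 2 - 2 * b * e = (q * b - 2 * e) ^ 2 / (2 * q) := by
      field_simp
      ring
    have h4 : 0 ≤ (q * b - 2 * e) ^ 2 / (2 * q) := by positivity
    linarith
  have hsum : (1 - q / 2) * normSq φ ≤
      ∑ v : V, (∑' n, g n + (2 / q) * ∑' n, ‖φ (n + c v) - φ n‖ ^ 2) := by
    have hs : ∀ v : V, Summable fun n => g (n + c v) + (2 / q) * ‖φ (n + c v) - φ n‖ ^ 2 :=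
      fun v => (hgsv v).add ((hds v).mul_left _)
    have := Summable.tsum_le_tsum hpt (hNs.mul_left _) (summable_sum fun v _ => hs v)
    rw [tsum_mul_left, Summable.tsum_finsetSum (fun v _ => hs v)] at this
    refine this.trans (le_of_eq (Finset.sum_congr rfl fun v _ => ?_))
    rw [(hgsv v).tsum_add ((hds v).mul_left _), tsum_mul_left]
    congr 1
    exact (Equiv.addRight (c v)).tsum_eq g
  have hQ : ∀ v : V, ∑' n, ‖φ (n + c v) - φ n‖ ^ 2 ≤ ((d : ℝ) * R) ^ 2 * energy φ := by
    intro v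
    refine (shift_bound hφ _ (fun i => (v i : ℕ)) rfl).trans ?_
    have : (∑ i, (v i : ℕ)) ≤ d * R := by
      refine (Finset.sum_le_card_nsmul _ _ R fun i _ => Nat.lt_succ_iff.mp (v i).2).trans ?_
      simp
    have h' : ((∑ i, (v i : ℕ) : ℕ) : ℝ) ≤ (d : ℝ) * R := by exact_mod_cast this
    gcongr
  have hcard : (Finset.univ : Finset V).card = (R + 1) ^ d := by simp [V]
  have hsum2 : (1 - q / 2) * normSq φ ≤
      ((R : ℝ) + 1) ^ d * (∑' n, g n + (2 / q) * (((d : ℝ) * R) ^ 2 * energy φ)) := by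
    refine hsum.trans ((Finset.sum_le_card_nsmul _ _ _ fun v _ =>
      add_le_add_right (mul_le_mul_of_nonneg_left (hQ v) (by positivity)) _).trans (le_of_eq ?_))
    rw [hcard]
    simp
    ring
  change ∑' n, g n ≥ _
  set S := ∑' n, g n
  have hS : 0 ≤ S := tsum_nonneg hg0
  set M : ℝ := (4 * (R : ℝ) + 1) ^ d with hM
  set P : ℝ := ((R : ℝ) + 1) ^ d with hP
  have hM1 : 1 ≤ M := one_le_pow₀ (by linarith [(Nat.cast_nonneg R : (0 : ℝ) ≤ R)])
  have hPM : P ≤ M := by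
    have : (0 : ℝ) ≤ R := Nat.cast_nonneg R
    rw [hP, hM]
    gcongr
    linarith
  have hd' : (0 : ℝ) < d := by exact_mod_cast hd
  have hR' : (0 : ℝ) < R := by exact_mod_cast hR
  have hM0 : 0 < M := by linarith
  have hP0 : 0 ≤ P := by positivity
  have hE2 : ((d : ℝ) * R) ^ 2 * energy φ ≤ q ^ 2 / (64 * M ^ 2) * normSq φ := by
    refine (mul_le_mul_of_nonneg_left hE (by positivity)).trans (le_of_eq ?_)
    have h2 : Real.sqrt 2 ^ 2 = 2 := Real.sq_sqrt (by norm_num)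
    rw [show (8 * Real.sqrt 2 * (d : ℝ) * R * M) ^ 2 = 128 * ((d : ℝ) * R) ^ 2 * M ^ 2 by
      linear_combination 64 * ((d : ℝ) * R) ^ 2 * M ^ 2 * h2]
    field_simp
    ring
  have hT : 0 ≤ (2 / q) * (((d : ℝ) * R) ^ 2 * energy φ) := by positivity
  have h5 : (1 - q / 2) * normSq φ ≤ M * S + M * ((2 / q) * (q ^ 2 / (64 * M ^ 2) * normSq φ)) := by
    calc _ ≤ P * (S + (2 / q) * (((d : ℝ) * R) ^ 2 * energy φ)) := hsum2
      _ ≤ M * (S + (2 / q) * (((d : ℝ) * R) ^ 2 * energy φ)) := by gcongr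
      _ ≤ M * (S + (2 / q) * (q ^ 2 / (64 * M ^ 2) * normSq φ)) := by gcongr
      _ = _ := by ring
  have h6 : M * ((2 / q) * (q ^ 2 / (64 * M ^ 2) * normSq φ)) = (q / 32 * normSq φ) / M := by
    field_simp
    ring
  have h7 : (q / 32 * normSq φ) / M ≤ q / 32 * normSq φ := div_le_self (by positivity) hM1
  have h8 : (1 - q) * normSq φ ≤ M * S := by
    have : 0 ≤ q * normSq φ := by positivity
    nlinarith
  rw [ge_iff_le, mul_right_comm, ← div_eq_mul_inv, div_le_iff₀ hM0]
  linarith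
end
end

section
/- Let D ⊆ ℤᵈ have strict uniform pattern frequency. Then for every finite set F ⊆ ℤᵈ there exists an infinite sequence (v_j)_{j∈ℕ} of distinct vectors in ℤᵈ such that the translates F + v_j are pairwise disjoint and each translate reproduces the pattern of D on F, i.e. (F + v_j) ∩ D = (F ∩ D) + v_j for every j ∈ ℕ. -/
open scoped BigOperators Classical

noncomputable section

/-- The cube `Λ_L(x)` as a `Finset`. -/
def cubeF (d : ℕ) (L : ℕ) (x : Fin d → ℤ) : Finset (Fin d → ℤ) :=
  Finset.Icc (fun i => x i - L) (fun i => x i + L)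

/-- The translate `F + v` reproduces the pattern of `D` on `F`:
`(F + v) ∩ D = (F ∩ D) + v`. -/
def Matches {d : ℕ} (D : Set (Fin d → ℤ)) (F : Finset (Fin d → ℤ)) (v : Fin d → ℤ) : Prop :=
  ((fun n => n + v) '' (F : Set (Fin d → ℤ))) ∩ D =
    (fun n => n + v) '' ((F : Set (Fin d → ℤ)) ∩ D)

/-- The empirical pattern frequency `η_{x,L}(F)` of the pattern of `D` on `F`. -/
def patternFreq {d : ℕ} (D : Set (Fin d → ℤ)) (F : Finset (Fin d → ℤ))
    (L : ℕ) (x : Fin d → ℤ) : ℝ :=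
  ((2 * (L : ℝ) + 1) ^ d)⁻¹ * ((cubeF d L x).filter fun v => Matches D F v).card

/-- `D` has strict uniform pattern frequency: for every finite pattern, the empirical
frequencies converge, uniformly in the center `x`, to a strictly positive limit. -/
def SUPF (d : ℕ) (D : Set (Fin d → ℤ)) : Prop :=
  ∀ F : Finset (Fin d → ℤ), ∃ η > (0 : ℝ), ∀ ε > (0 : ℝ), ∃ L₀ : ℕ, ∀ L : ℕ, L₀ ≤ L →
    ∀ x : Fin d → ℤ, |patternFreq D F L x - η| < ε

theorem statement8 (d : ℕ) (hd : 1 ≤ d) (D : Set (Fin d → ℤ)) (hD : SUPF d D)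
    (F : Finset (Fin d → ℤ)) :
    ∃ v : ℕ → Fin d → ℤ, Function.Injective v ∧
      (∀ j k, j ≠ k →
        Disjoint ((fun n => n + v j) '' (F : Set (Fin d → ℤ)))
          ((fun n => n + v k) '' (F : Set (Fin d → ℤ)))) ∧
      ∀ j, ((fun n => n + v j) '' (F : Set (Fin d → ℤ))) ∩ D =
        (fun n => n + v j) '' ((F : Set (Fin d → ℤ)) ∩ D) := by
  obtain ⟨η, hη, h⟩ := hD F
  obtain ⟨L, hL⟩ := h η hη
  have key : ∀ x : Fin d → ℤ, ∃ v ∈ cubeF d L x, Matches D F v := by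
    intro x
    by_contra hcon
    push Not at hcon
    have h1 := hL L le_rfl x
    have h2 : (cubeF d L x).filter (fun v => Matches D F v) = ∅ :=
      Finset.filter_eq_empty_iff.2 fun {v} hv => hcon v hv
    rw [patternFreq, h2] at h1
    simp [abs_of_pos hη] at h1
  let i₀ : Fin d := ⟨0, hd⟩
  let M : ℕ := ∑ n ∈ F, (n i₀).natAbs
  have hM : ∀ n ∈ F, (n i₀).natAbs ≤ M := fun n hn =>
    Finset.single_le_sum (f := fun n : Fin d → ℤ => (n i₀).natAbs)
      (fun _ _ => Nat.zero_le _) hn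
  choose v hv hmatch using fun j : ℕ => key (fun _ => (2 * L + 2 * M + 1 : ℤ) * j)
  have hb : ∀ j, (2 * L + 2 * M + 1 : ℤ) * j - L ≤ v j i₀ ∧
      v j i₀ ≤ (2 * L + 2 * M + 1 : ℤ) * j + L := by
    intro j
    have := Finset.mem_Icc.1 (hv j)
    exact ⟨this.1 i₀, this.2 i₀⟩
  have hlt : ∀ j k : ℕ, j < k → v j i₀ + 2 * M < v k i₀ := by
    intro j k hjk
    have h1 := (hb j).2
    have h2 := (hb k).1
    have h3 : (2 * L + 2 * M + 1 : ℤ) * (j + 1) ≤ (2 * L + 2 * M + 1 : ℤ) * k :=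
      mul_le_mul_of_nonneg_left (by exact_mod_cast hjk) (by positivity)
    linarith
  refine ⟨v, ?_, ?_, hmatch⟩
  · intro j k hjk
    have e := congrFun hjk i₀
    rcases lt_trichotomy j k with hh | hh | hh
    · have := hlt _ _ hh
      omega
    · exact hh
    · have := hlt _ _ hh
      omega
  · intro j k hjk
    rw [Set.disjoint_left]
    rintro _ ⟨a, ha, rfl⟩ ⟨b, hb', he⟩
    have e : b i₀ + v k i₀ = a i₀ + v j i₀ := congrFun he i₀
    have ha' := hM a ha
    have hb'' := hM b hb'
    rcases lt_or_gt_of_ne hjk with hh | hh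
    · have := hlt _ _ hh
      omega
    · have := hlt _ _ hh
      omega
end
end

section
/- (The spectrum of the background operator is purely essential.) Let d ≥ 1, M > 0, and let D ⊆ ℤᵈ be an R-Delone set with strict uniform pattern frequency. Then every E in the spectrum σ(T₀) of T₀ admits an orthonormal sequence (ψ_k)_{k∈ℕ} in ℓ²(ℤᵈ) with ‖(T₀ − E)ψ_k‖ → 0 as k → ∞; in particular the spectrum of T₀ coincides with its essential spectrum. -/
open scoped BigOperators Classical

noncomputable section

/-- The sequence space `ℓ²(ℤᵈ)`. -/
abbrev ell2 (d : ℕ) := lp (fun _ : Fin d → ℤ => ℂ) 2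

lemma oneNorm_sub_comm {d : ℕ} (a b : Fin d → ℤ) : oneNorm (a - b) = oneNorm (b - a) := by
  unfold oneNorm
  refine Finset.sum_congr rfl fun i _ => ?_
  simp only [Pi.sub_apply]
  omega

/-- Value of `T` on a Kronecker delta. -/
lemma T_single {d : ℕ} (M : ℝ) (D : Set (Fin d → ℤ)) (T : ell2 d →L[ℂ] ell2 d)
    (hT : ∀ (u : ell2 d) (n : Fin d → ℤ),
      T u n = (∑' m : Fin d → ℤ, if oneNorm (m - n) = 1 then u m else 0) +
        2 * (d : ℂ) * u n + (if n ∈ D then 0 else (M : ℂ) * u n)) (a b : Fin d → ℤ) :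
    T (lp.single 2 a (1 : ℂ)) b = (if oneNorm (a - b) = 1 then 1 else 0) +
      2 * (d : ℂ) * (if a = b then 1 else 0) +
      (if b ∈ D then 0 else (M : ℂ) * (if a = b then 1 else 0)) := by
  have h1 : ∀ b : Fin d → ℤ, (lp.single 2 a (1 : ℂ) : ell2 d) b = if a = b then 1 else 0 := by
    intro b
    rw [lp.single_apply, Pi.single_apply]
    simp only [eq_comm]
  rw [hT, h1, tsum_eq_single a]
  · rw [h1]; simp
  · intro m hm
    rw [h1, if_neg (Ne.symm hm)]; simp

lemma T_selfAdjoint {d : ℕ} (M : ℝ) (D : Set (Fin d → ℤ)) (T : ell2 d →L[ℂ] ell2 d)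
    (hT : ∀ (u : ell2 d) (n : Fin d → ℤ),
      T u n = (∑' m : Fin d → ℤ, if oneNorm (m - n) = 1 then u m else 0) +
        2 * (d : ℂ) * u n + (if n ∈ D then 0 else (M : ℂ) * u n)) : IsSelfAdjoint T := by
  rw [ContinuousLinearMap.isSelfAdjoint_iff']
  have key : ∀ a, (ContinuousLinearMap.adjoint T) (lp.single 2 a (1 : ℂ)) =
      T (lp.single 2 a (1 : ℂ)) := by
    intro a
    ext b
    have h := ContinuousLinearMap.adjoint_inner_right T (lp.single 2 b (1 : ℂ) : ell2 d)
      (lp.single 2 a (1 : ℂ))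
    rw [lp.inner_single_left, lp.inner_single_right] at h
    simp only [RCLike.inner_apply, map_one, mul_one, one_mul] at h
    rw [h, T_single M D T hT, T_single M D T hT, oneNorm_sub_comm b a]
    by_cases hab : a = b
    · subst hab
      have h2 : (starRingEnd ℂ) 2 = 2 := Complex.conj_ofNat 2
      by_cases ha : a ∈ D <;> simp [ha, apply_ite, h2]
    · simp [hab, Ne.symm hab, apply_ite]
  ext1 u
  have hs := lp.hasSum_single (p := 2) (by simp) u
  have e : ∀ S : ell2 d →L[ℂ] ell2 d, ∀ i, S (lp.single 2 i (u i)) =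
      u i • S (lp.single 2 i (1 : ℂ)) := by
    intro S i
    rw [← map_smul, ← lp.single_smul]
    simp
  refine (hs.mapL (ContinuousLinearMap.adjoint T)).unique ?_
  convert hs.mapL T using 1
  ext1 i
  rw [e, e, key]

/-- Approximate eigenvectors for a point in the spectrum of a self-adjoint operator. -/
lemma exists_approx {H : Type*} [NormedAddCommGroup H] [InnerProductSpace ℂ H] [CompleteSpace H]
    (T : H →L[ℂ] H) (hT : IsSelfAdjoint T) (E : ℂ) (hE : E ∈ spectrum ℂ T) (ε : ℝ) (hε : 0 < ε) :
    ∃ u : H, ‖T u - E • u‖ < ε * ‖u‖ := by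
  by_contra! hcon
  apply hE
  have hn : IsStarNormal (algebraMap ℂ (H →L[ℂ] H) E - T) := by
    constructor
    rw [star_sub, hT.star_eq, ← algebraMap_star_comm]
    have h1 : ∀ z : ℂ, Commute (algebraMap ℂ (H →L[ℂ] H) z) T := fun z => Algebra.commutes z T
    have h2 : ∀ z : ℂ, Commute (algebraMap ℂ (H →L[ℂ] H) z) (algebraMap ℂ (H →L[ℂ] H) E) :=
      fun z => Algebra.commutes z _
    exact ((h2 _).sub_right (h1 _)).sub_left ((h1 E).symm.sub_right (Commute.refl T))
  set A := algebraMap ℂ (H →L[ℂ] H) E - T with hA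
  have hb : ∀ u, ε * ‖u‖ ≤ ‖A u‖ := by
    intro u
    have : A u = -(T u - E • u) := by
      simp [hA, Algebra.algebraMap_eq_smul_one]
    rw [this, norm_neg]
    exact hcon u
  change IsUnit A
  rw [ContinuousLinearMap.isUnit_iff_bijective,
    ContinuousLinearMap.bijective_iff_dense_range_and_antilipschitz]
  refine ⟨?_, ⟨(Real.toNNReal ε)⁻¹, ?_⟩⟩
  · rw [Submodule.topologicalClosure_eq_top_iff, ContinuousLinearMap.IsStarNormal.orthogonal_range hn,
      Submodule.eq_bot_iff]
    intro x hx
    have hx' : A x = 0 := hx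
    have := hb x
    rw [hx', norm_zero] at this
    have h3 : ‖x‖ ≤ 0 := by
      by_contra! h
      nlinarith [mul_pos hε h]
    simpa using h3
  · refine A.antilipschitz_of_bound fun x => ?_
    have h := hb x
    rw [NNReal.coe_inv, Real.coe_toNNReal ε hε.le, inv_mul_eq_div, le_div_iff₀ hε]
    linarith

/-- Finitely supported approximate eigenvectors. -/
lemma exists_approx_fin {d : ℕ} (T : ell2 d →L[ℂ] ell2 d) (E : ℂ) (ε : ℝ) (u : ell2 d)
    (hu : ‖T u - E • u‖ < ε * ‖u‖) :
    ∃ (w : ell2 d) (S : Finset (Fin d → ℤ)), (∀ n, n ∉ S → w n = 0) ∧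
      ‖T w - E • w‖ < ε * ‖w‖ := by
  have ho : IsOpen {w : ell2 d | ‖T w - E • w‖ < ε * ‖w‖} :=
    isOpen_lt (by fun_prop) (by fun_prop)
  have hs : Filter.Tendsto (fun S : Finset (Fin d → ℤ) => ∑ i ∈ S, lp.single 2 i (u i))
    Filter.atTop (nhds u) := lp.hasSum_single (p := 2) (by simp) u
  obtain ⟨S, hS⟩ := (hs.eventually (ho.mem_nhds hu)).exists
  refine ⟨_, S, ?_, hS⟩
  intro n hn
  rw [lp.coeFn_sum, Finset.sum_apply]
  refine Finset.sum_eq_zero fun i hi => ?_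
  exact lp.single_apply_ne _ _ _ (fun h => hn (h ▸ hi))

/-- Translation of an `ℓ²` vector. -/
def transl {d : ℕ} (v : Fin d → ℤ) (u : ell2 d) : ell2 d :=
  ⟨fun n => u (n - v), by
    have h := (lp.memℓp u).summable (by norm_num)
    exact memℓp_gen ((Equiv.subRight v).summable_iff.mpr h)⟩

lemma transl_apply {d : ℕ} (v : Fin d → ℤ) (u : ell2 d) (n : Fin d → ℤ) :
    transl v u n = u (n - v) := rfl

lemma norm_transl {d : ℕ} (v : Fin d → ℤ) (u : ell2 d) : ‖transl v u‖ = ‖u‖ := by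
  rw [lp.norm_eq_tsum_rpow (by norm_num), lp.norm_eq_tsum_rpow (by norm_num)]
  congr 1
  exact (Equiv.subRight v).tsum_eq (fun n => ‖u n‖ ^ (ENNReal.toReal 2))

lemma Matches.iff {d : ℕ} {D : Set (Fin d → ℤ)} {F : Finset (Fin d → ℤ)} {v : Fin d → ℤ}
    (h : Matches D F v) {n : Fin d → ℤ} (hn : n ∈ F) : n + v ∈ D ↔ n ∈ D := by
  constructor
  · intro hD
    have : n + v ∈ (fun n => n + v) '' ((F : Set (Fin d → ℤ)) ∩ D) := by
      rw [← h]
      exact ⟨⟨n, hn, rfl⟩, hD⟩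
    obtain ⟨m, hm, hmn⟩ := this
    have : m = n := add_right_cancel hmn
    exact this ▸ hm.2
  · intro hD
    have : n + v ∈ (fun n => n + v) '' ((F : Set (Fin d → ℤ)) ∩ D) := ⟨n, ⟨hn, hD⟩, rfl⟩
    rw [← h] at this
    exact this.2

lemma T_transl {d : ℕ} (M : ℝ) (D : Set (Fin d → ℤ)) (T : ell2 d →L[ℂ] ell2 d)
    (hT : ∀ (u : ell2 d) (n : Fin d → ℤ),
      T u n = (∑' m : Fin d → ℤ, if oneNorm (m - n) = 1 then u m else 0) +
        2 * (d : ℂ) * u n + (if n ∈ D then 0 else (M : ℂ) * u n))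
    (w : ell2 d) (S : Finset (Fin d → ℤ)) (hw : ∀ n, n ∉ S → w n = 0) (v : Fin d → ℤ)
    (hv : Matches D S v) : T (transl v w) = transl v (T w) := by
  ext n
  rw [transl_apply, hT, hT, transl_apply]
  congr 1
  · congr 1
    rw [← (Equiv.addRight v).tsum_eq]
    refine tsum_congr fun m => ?_
    simp [transl_apply, sub_sub_eq_add_sub]
  · by_cases h : n - v ∈ S
    · have := hv.iff h
      rw [sub_add_cancel] at this
      simp only [this]
    · simp [hw _ h]

/-- Patterns recur outside of every finite set. -/
lemma exists_match {d : ℕ} (hd : 1 ≤ d) (D : Set (Fin d → ℤ)) (hD : SUPF d D)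
    (F Bad : Finset (Fin d → ℤ)) : ∃ v, v ∉ Bad ∧ Matches D F v := by
  obtain ⟨η, hη, h⟩ := hD F
  obtain ⟨L, hL⟩ := h η hη
  obtain ⟨C, hC⟩ := (Bad.image fun v => v ⟨0, hd⟩).bddAbove
  have h1 := hL L le_rfl (fun _ => C + L + 1)
  have h2 : 0 < patternFreq D F L (fun _ => C + L + 1) := by
    have := (abs_lt.mp h1).1
    linarith
  have h3 : ((cubeF d L (fun _ => C + L + 1)).filter fun v => Matches D F v).Nonempty := by
    rw [Finset.nonempty_iff_ne_empty]
    intro h0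
    simp [patternFreq, h0] at h2
  obtain ⟨v, hv⟩ := h3
  rw [Finset.mem_filter, cubeF, Finset.mem_Icc] at hv
  refine ⟨v, fun hb => ?_, hv.2⟩
  have h4 : v ⟨0, hd⟩ ≤ C := hC (Finset.mem_coe.mpr (Finset.mem_image_of_mem _ hb))
  have h5 := hv.1.1 ⟨0, hd⟩
  simp only at h5
  omega

/-- Normalized approximate eigenvectors supported away from a given finite set. -/
lemma exists_good {d : ℕ} (hd : 1 ≤ d) (M : ℝ) (D : Set (Fin d → ℤ)) (hD : SUPF d D)
    (T : ell2 d →L[ℂ] ell2 d)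
    (hT : ∀ (u : ell2 d) (n : Fin d → ℤ),
      T u n = (∑' m : Fin d → ℤ, if oneNorm (m - n) = 1 then u m else 0) +
        2 * (d : ℂ) * u n + (if n ∈ D then 0 else (M : ℂ) * u n))
    (E : ℂ) (hE : E ∈ spectrum ℂ T) (ε : ℝ) (hε : 0 < ε) (B : Finset (Fin d → ℤ)) :
    ∃ (ψ : ell2 d) (A : Finset (Fin d → ℤ)), ‖ψ‖ = 1 ∧ (∀ n, n ∉ A → ψ n = 0) ∧
      Disjoint A B ∧ ‖T ψ - E • ψ‖ < ε := by
  obtain ⟨u, hu⟩ := exists_approx T (T_selfAdjoint M D T hT) E hE ε hε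
  obtain ⟨w, S, hS, hw⟩ := exists_approx_fin T E ε u hu
  obtain ⟨v, hvB, hv⟩ := exists_match hd D hD S
    ((B ×ˢ S).image fun p => p.1 - p.2)
  have hw0 : 0 < ‖w‖ := by
    by_contra! h
    have := norm_nonneg (T w - E • w)
    nlinarith [norm_nonneg w]
  have hc : ‖((‖w‖⁻¹ : ℝ) : ℂ)‖ = ‖w‖⁻¹ := by simp
  refine ⟨((‖w‖⁻¹ : ℝ) : ℂ) • transl v w, S.image (· + v), ?_, ?_, ?_, ?_⟩
  · rw [norm_smul, norm_transl, hc, inv_mul_cancel₀ hw0.ne']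
  · intro n hn
    have : n - v ∉ S := fun h => hn (Finset.mem_image.mpr ⟨n - v, h, by simp⟩)
    rw [lp.coeFn_smul, Pi.smul_apply, transl_apply, hS _ this, smul_zero]
  · rw [Finset.disjoint_left]
    intro n hn hnB
    obtain ⟨s, hs, rfl⟩ := Finset.mem_image.mp hn
    exact hvB (Finset.mem_image.mpr ⟨(s + v, s), Finset.mem_product.mpr ⟨hnB, hs⟩, by simp⟩)
  · have e : T (((‖w‖⁻¹ : ℝ) : ℂ) • transl v w) - E • (((‖w‖⁻¹ : ℝ) : ℂ) • transl v w) =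
        ((‖w‖⁻¹ : ℝ) : ℂ) • transl v (T w - E • w) := by
      rw [map_smul, T_transl M D T hT w S hS v hv, smul_comm E, ← smul_sub]
      rfl
    rw [e, norm_smul, norm_transl, hc, inv_mul_eq_div, div_lt_iff₀ hw0]
    exact hw

theorem statement9 (d R : ℕ) (hd : 1 ≤ d) (hR : 1 ≤ R) (M : ℝ) (hM : 0 < M)
    (D : Set (Fin d → ℤ)) (hDel : IsDeloneSet d R D) (hD : SUPF d D)
    (T : ell2 d →L[ℂ] ell2 d)
    (hT : ∀ (u : ell2 d) (n : Fin d → ℤ),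
      T u n = (∑' m : Fin d → ℤ, if oneNorm (m - n) = 1 then u m else 0) +
        2 * (d : ℂ) * u n + (if n ∈ D then 0 else (M : ℂ) * u n))
    (E : ℂ) (hE : E ∈ spectrum ℂ T) :
    ∃ ψ : ℕ → ell2 d, Orthonormal ℂ ψ ∧
      Filter.Tendsto (fun k => ‖T (ψ k) - E • ψ k‖) Filter.atTop (nhds 0) := by
  obtain ⟨f, hf, hr⟩ := exists_seq_of_forall_finset_exists
    (α := ℕ × ell2 d × Finset (Fin d → ℤ))
    (fun x => ‖x.2.1‖ = 1 ∧ (∀ n, n ∉ x.2.2 → x.2.1 n = 0) ∧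
      ‖T x.2.1 - E • x.2.1‖ < 1 / ((x.1 : ℝ) + 1))
    (fun x y => x.1 < y.1 ∧ Disjoint y.2.2 x.2.2) (by
      intro s _
      obtain ⟨ψ, A, h1, h2, h3, h4⟩ := exists_good hd M D hD T hT E hE
        (1 / (((s.sup (fun x => x.1) + 1 : ℕ) : ℝ) + 1)) (by positivity)
        (s.biUnion fun x => x.2.2)
      refine ⟨(s.sup (fun x => x.1) + 1, ψ, A), ⟨h1, h2, h4⟩, fun x hx => ⟨?_, ?_⟩⟩
      · exact Nat.lt_succ_of_le (Finset.le_sup (f := fun x => x.1) hx)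
      · exact (Finset.disjoint_biUnion_right _ _ _).mp h3 x hx)
  have hmono : StrictMono fun k => (f k).1 := fun m n hmn => (hr m n hmn).1
  have horth : ∀ m n, m < n → inner ℂ (f m).2.1 (f n).2.1 = 0 := by
    intro m n hmn
    rw [lp.inner_eq_tsum]
    refine (tsum_congr fun i => ?_).trans tsum_zero
    by_cases hi : i ∈ (f m).2.2
    · have : i ∉ (f n).2.2 := fun h => Finset.disjoint_left.mp (hr m n hmn).2 h hi
      rw [(hf n).2.1 i this, inner_zero_right]
    · rw [(hf m).2.1 i hi, inner_zero_left]
  refine ⟨fun k => (f k).2.1, ⟨fun k => (hf k).1, ?_⟩, ?_⟩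
  · intro m n hmn
    rcases lt_or_gt_of_ne hmn with h | h
    · exact horth m n h
    · exact inner_eq_zero_symm.mp (horth n m h)
  · refine squeeze_zero (fun _ => norm_nonneg _) (fun k => ?_)
      tendsto_one_div_add_atTop_nhds_zero_nat
    refine (hf k).2.2.le.trans ?_
    have : (k : ℝ) ≤ (f k).1 := by exact_mod_cast hmono.le_apply
    exact one_div_le_one_div_of_le (by positivity) (by linarith)
end
end
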